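/- Let A and B be unital C*-algebras, φ₁, φ₂: A → B unital completely positive maps with commuting ranges (φ₁(x)φ₂(y) = φ₂(y)φ₁(x) for all x,y ∈ A). If A is finite-dimensional, then the linear map φ₁·φ₂: A ⊗ A → B determined by x ⊗ y ↦ φ₁(x)φ₂(y) is a unital completely positive map. -/

import Mathlib

open scoped TensorProduct

/-- The star operation on `A ⊗[ℂ] B`, determined by `star (a ⊗ b) = star a ⊗ star b`. -/
noncomputable instance tensorStar {A B : Type*} [AddCommMonoid A] [AddCommMonoid B]
    [Module ℂ A] [Module ℂ B] [StarAddMonoid A] [StarAddMonoid B]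
    [StarModule ℂ A] [StarModule ℂ B] : Star (A ⊗[ℂ] B) where
  star t := TensorProduct.liftAddHom
    { toFun := fun a =>
        { toFun := fun b => star a ⊗ₜ[ℂ] star b
          map_zero' := by simp
          map_add' := fun b c => by simp [star_add, TensorProduct.tmul_add] }
      map_zero' := by ext b; simp
      map_add' := fun a b => by ext c; simp [star_add, TensorProduct.add_tmul] }
    (fun r a b => by simp [star_smul, TensorProduct.smul_tmul]) t

/-- A linear map `φ` between star algebras is completely positive if each of its matrix
amplifications maps positive elements (elements of the form `star y * y`) to positive
elements. -/
def IsCompletelyPositive {A B : Type*} [Ring A] [Star A] [Module ℂ A]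
    [Ring B] [Star B] [Module ℂ B] (φ : A →ₗ[ℂ] B) : Prop :=
  ∀ (m : ℕ) (y : Matrix (Fin m) (Fin m) A),
    ∃ z : Matrix (Fin m) (Fin m) B, (star y * y).map φ = star z * z

theorem gen_sqrt {M : Type*} [CStarAlgebra M] (z : M) :
    ∃ s : M, star s = s ∧ s * s = star z * z ∧
      ∀ d, Commute (star z * z) d → Commute s d := by
  let _ := CStarAlgebra.spectralOrder M
  have _ := CStarAlgebra.spectralOrderedRing M
  have h0 : 0 ≤ star z * z := star_mul_self_nonneg z
  refine ⟨CFC.sqrt (star z * z), (CFC.sqrt_nonneg _).isSelfAdjoint.star_eq,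
    CFC.sqrt_mul_sqrt_self _ h0, fun d hd => ?_⟩
  exact hd.cfcₙ_nnreal NNReal.sqrt

theorem gen_sum {M κ : Type*} [CStarAlgebra M] [Fintype κ] (w : κ → M) :
    ∃ z : M, ∑ k, star (w k) * w k = star z * z := by
  let _ := CStarAlgebra.spectralOrder M
  have _ := CStarAlgebra.spectralOrderedRing M
  have h0 : 0 ≤ ∑ k, star (w k) * w k := Finset.sum_nonneg fun k _ => star_mul_self_nonneg _
  exact CStarAlgebra.nonneg_iff_eq_star_mul_self.mp h0

theorem aux_sqrt {B ι : Type*} [CStarAlgebra B] [Fintype ι] [DecidableEq ι]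
    (X z : ι → ι → B) (h : ∀ i j, X i j = ∑ k, star (z k i) * z k j) :
    ∃ S : ι → ι → B, (∀ i j, star (S i j) = S j i) ∧
      (∀ i j, X i j = ∑ k, star (S k i) * S k j) ∧
      ∀ c, (∀ i j, Commute c (X i j)) → ∀ i j, Commute c (S i j) := by
  let _ := CStarAlgebra.spectralOrder B
  have _ := CStarAlgebra.spectralOrderedRing B
  let z' : CStarMatrix ι ι B := CStarMatrix.ofMatrix z
  have hX : ∀ i j, (star z' * z') i j = X i j := by
    intro i j
    rw [CStarMatrix.mul_apply]
    exact (h i j).symm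
  obtain ⟨S, hs, hss, hc⟩ := gen_sqrt z'
  have hS : ∀ i j, star (S i j) = S j i := by
    intro i j
    exact congrFun (congrFun hs j) i
  refine ⟨fun i j => S i j, hS, ?_, ?_⟩
  · intro i j
    simp only [hS]
    rw [← hX]
    have : (S * S) i j = (star z' * z') i j := congrFun (congrFun hss i) j
    rw [← this, CStarMatrix.mul_apply]
  · intro c hcX i j
    let D : CStarMatrix ι ι B := CStarMatrix.ofMatrix (Matrix.diagonal fun _ => c)
    have hl : ∀ (M : CStarMatrix ι ι B) i j, (D * M) i j = c * M i j := fun M i j =>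
      Matrix.diagonal_mul (fun _ => c) (CStarMatrix.ofMatrix.symm M) i j
    have hr : ∀ (M : CStarMatrix ι ι B) i j, (M * D) i j = M i j * c := fun M i j =>
      Matrix.mul_diagonal (fun _ => c) (CStarMatrix.ofMatrix.symm M) i j
    have hD : star z' * z' * D = D * (star z' * z') := by
      ext i j
      rw [hl, hr, hX]
      exact (hcX i j).symm
    have h2 : (S * D) i j = (D * S) i j := congrFun (congrFun (hc D hD) i) j
    rw [hl, hr] at h2
    exact h2.symm

theorem aux_row {B : Type*} [Ring B] [StarRing B] (m : ℕ) (v : Fin m → B) :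
    ∃ z : Matrix (Fin m) (Fin m) B, ∀ i j, star (v i) * v j = (star z * z) i j := by
  rcases m with _ | m
  · exact ⟨0, fun i => i.elim0⟩
  · refine ⟨Matrix.of fun k i => if k = 0 then v i else 0, fun i j => ?_⟩
    rw [Matrix.mul_apply, Finset.sum_eq_single 0]
    · simp [Matrix.star_apply]
    · intro b _ hb; simp [hb]
    · simp

theorem aux_rows {B κ : Type*} [CStarAlgebra B] [Fintype κ] (m : ℕ) (Z : κ → Fin m → B) :
    ∃ z : Matrix (Fin m) (Fin m) B, ∀ i j, ∑ k, star (Z k i) * Z k j = (star z * z) i j := by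
  let _ := CStarAlgebra.spectralOrder B
  have _ := CStarAlgebra.spectralOrderedRing B
  choose w hw using fun k => aux_row m (Z k)
  let w' : κ → CStarMatrix (Fin m) (Fin m) B := fun k => CStarMatrix.ofMatrix (w k)
  obtain ⟨z, hz⟩ := gen_sum w'
  refine ⟨CStarMatrix.ofMatrix.symm z, fun i j => ?_⟩
  have h1 : (∑ k, star (w k) * w k : Matrix (Fin m) (Fin m) B) i j
      = (star z * z) i j := congrFun (congrFun hz i) j
  rw [Matrix.sum_apply] at h1
  simp only [hw]
  exact h1

theorem aux_cp {A B ι : Type*} [CStarAlgebra A] [CStarAlgebra B] [Fintype ι]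
    (φ : A →ₗ[ℂ] B) (h : IsCompletelyPositive φ) (a : ι → A) :
    ∃ z : ι → ι → B, ∀ u v, φ (star (a u) * a v) = ∑ k, star (z k u) * z k v := by
  let e := Fintype.equivFin ι
  obtain ⟨y, hy⟩ := aux_row (Fintype.card ι) (fun i => a (e.symm i))
  obtain ⟨z, hz⟩ := h _ y
  refine ⟨fun i j => z (e i) (e j), fun u v => ?_⟩
  have h1 := hy (e u) (e v)
  have h2 := congrFun (congrFun hz (e u)) (e v)
  rw [Matrix.map_apply, ← h1, Matrix.mul_apply] at h2
  simp only [Equiv.symm_apply_apply, Matrix.star_apply] at h2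
  rw [h2]
  exact (Equiv.sum_comp e (fun k => star (z k (e u)) * z k (e v))).symm

theorem aux_star_tmul {A : Type*} [CStarAlgebra A] (a b : A) :
    star (a ⊗ₜ[ℂ] b) = star a ⊗ₜ[ℂ] star b := rfl

theorem aux_star_sum {A κ : Type*} [CStarAlgebra A] (s : Finset κ) (f : κ → A ⊗[ℂ] A) :
    star (∑ k ∈ s, f k) = ∑ k ∈ s, star (f k) := by
  simp only [star, map_sum]

theorem aux_alg {B κ μ ν : Type*} [Ring B] [StarRing B] [Fintype κ] [Fintype μ] [Fintype ν]
    (x x' : μ → κ → B) (w : ν → κ → B)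
    (h : ∀ r s k l, Commute (x r k) (w s l)) (h' : ∀ r s k l, Commute (x' r k) (star (w s l))) :
    ∑ k, ∑ l, (∑ r, star (x r k) * x' r l) * (∑ s, star (w s k) * w s l) =
      ∑ r, ∑ s, star (∑ k, x r k * w s k) * (∑ l, x' r l * w s l) := by
  have e : ∀ r s k l, (star (x r k) * x' r l) * (star (w s k) * w s l) =
      star (x r k * w s k) * (x' r l * w s l) := by
    intro r s k l
    rw [(h r s k k).eq, star_mul]
    simp only [mul_assoc]
    rw [← mul_assoc (x' r l), (h' r s l k).eq, mul_assoc]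
  simp only [star_sum, Finset.sum_mul_sum, e]
  calc _ = ∑ k, ∑ r, ∑ l, ∑ s, star (x r k * w s k) * (x' r l * w s l) :=
        Finset.sum_congr rfl fun k _ => Finset.sum_comm
    _ = ∑ r, ∑ k, ∑ l, ∑ s, star (x r k * w s k) * (x' r l * w s l) := Finset.sum_comm
    _ = ∑ r, ∑ k, ∑ s, ∑ l, star (x r k * w s k) * (x' r l * w s l) :=
        Finset.sum_congr rfl fun r _ => Finset.sum_congr rfl fun k _ => Finset.sum_comm
    _ = _ := Finset.sum_congr rfl fun r _ => Finset.sum_comm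

/-- If `φ₁, φ₂ : A → B` are unital completely positive maps with commuting ranges on a
finite-dimensional unital C*-algebra `A`, then the map `φ₁·φ₂ : A ⊗ A → B` determined by
`x ⊗ y ↦ φ₁(x)φ₂(y)` is a unital completely positive map. -/
theorem product_of_commuting_ucp_maps
    {A B : Type*} [CStarAlgebra A] [CStarAlgebra B] [FiniteDimensional ℂ A]
    (φ₁ φ₂ : A →ₗ[ℂ] B)
    (h₁u : φ₁ 1 = 1) (h₂u : φ₂ 1 = 1)
    (h₁cp : IsCompletelyPositive φ₁) (h₂cp : IsCompletelyPositive φ₂)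
    (hcomm : ∀ x y : A, φ₁ x * φ₂ y = φ₂ y * φ₁ x) :
    ∃ T : A ⊗[ℂ] A →ₗ[ℂ] B,
      (∀ x y : A, T (x ⊗ₜ[ℂ] y) = φ₁ x * φ₂ y) ∧ T 1 = 1 ∧ IsCompletelyPositive T := by
  classical
  refine ⟨LinearMap.mul' ℂ B ∘ₗ TensorProduct.map φ₁ φ₂, fun x y => by simp, ?_, ?_⟩
  · rw [Algebra.TensorProduct.one_def]; simp [h₁u, h₂u]
  intro m y
  let b := Module.finBasis ℂ A
  have hy : ∀ p i, ∃ a : Fin (Module.finrank ℂ A) → A, y p i = ∑ k, a k ⊗ₜ[ℂ] b k := by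
    intro p i
    induction y p i using TensorProduct.induction_on with
    | zero => exact ⟨0, by simp⟩
    | tmul x c =>
      refine ⟨fun k => b.repr c k • x, ?_⟩
      conv_lhs => rw [← b.sum_repr c]
      rw [TensorProduct.tmul_sum]
      exact Finset.sum_congr rfl fun k _ => (TensorProduct.smul_tmul _ _ _).symm
    | add s t hs ht =>
      obtain ⟨a, ha⟩ := hs
      obtain ⟨c, hc⟩ := ht
      exact ⟨a + c, by simp [ha, hc, TensorProduct.add_tmul, Finset.sum_add_distrib]⟩
  choose a ha using hy
  obtain ⟨w₀, hw₀⟩ := aux_cp φ₂ h₂cp b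
  obtain ⟨w, hws, hw, hwc⟩ := aux_sqrt (fun k l => φ₂ (star (b k) * b l)) w₀ hw₀
  choose x₀ hx₀ using fun p => aux_cp φ₁ h₁cp
    (fun u : Fin m × Fin (Module.finrank ℂ A) => a p u.1 u.2)
  choose x hxs hx hxc using fun p => aux_sqrt
    (fun u v : Fin m × Fin (Module.finrank ℂ A) => φ₁ (star (a p u.1 u.2) * a p v.1 v.2))
    (x₀ p) (hx₀ p)
  have hxw : ∀ p r u s l, Commute (x p r u) (w s l) := fun p r u s l =>
    hwc _ (fun k l => (hxc p _ (fun u v => (hcomm _ _).symm) r u).symm) s l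
  obtain ⟨z, hz⟩ := aux_rows m
    (fun (q : Fin m × (Fin m × Fin (Module.finrank ℂ A)) × Fin (Module.finrank ℂ A)) i =>
      ∑ k, x q.1 q.2.1 (i, k) * w q.2.2 k)
  refine ⟨z, ?_⟩
  ext i j
  rw [← hz, Matrix.map_apply, Matrix.mul_apply, map_sum, Fintype.sum_prod_type]
  refine Finset.sum_congr rfl fun p _ => ?_
  rw [Fintype.sum_prod_type, ← aux_alg (fun r k => x p r (i, k)) (fun r k => x p r (j, k)) w
    (fun r s k l => hxw p r _ s l) (fun r s k l => by rw [hws]; exact hxw p r _ l s)]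
  rw [Matrix.star_apply, ha, ha, aux_star_sum, Finset.sum_mul_sum, map_sum]
  refine Finset.sum_congr rfl fun k _ => ?_
  rw [map_sum]
  refine Finset.sum_congr rfl fun l _ => ?_
  rw [← hw, ← hx p (i, k) (j, l), aux_star_tmul, Algebra.TensorProduct.tmul_mul_tmul]
  simp
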